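/- arXiv:2110.01030 — 5 statements merged into one kernel-verified Lean document; each statement's English description precedes it below -/
import Mathlib

section
/- For every positional MAX strategy σ in a simple stochastic game G, there exists a positional MIN strategy τ that is a best response to σ, i.e., v_{σ,τ} ≤ v_{σ,τ'} pointwise for every positional MIN strategy τ'. -/
open scoped BigOperators

instance : Fact ((0:ℝ) ≤ 1) := ⟨zero_le_one⟩

/-- A simple stochastic game on a finite vertex set `V`. -/
structure SSG (V : Type*) [Fintype V] [DecidableEq V] where
  /-- MAX vertices -/
  VMax : Finset V
  /-- MIN vertices -/
  VMin : Finset V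
  /-- random vertices -/
  VR : Finset V
  /-- sink vertices -/
  VS : Finset V
  cover : ∀ x : V, x ∈ VMax ∨ x ∈ VMin ∨ x ∈ VR ∨ x ∈ VS
  disjMaxMin : Disjoint VMax VMin
  disjMaxR : Disjoint VMax VR
  disjMaxS : Disjoint VMax VS
  disjMinR : Disjoint VMin VR
  disjMinS : Disjoint VMin VS
  disjRS : Disjoint VR VS
  /-- out-neighbourhood: `y ∈ succ x` iff `(x,y)` is an edge -/
  succ : V → Finset V
  outMax : ∀ x ∈ VMax, 2 ≤ (succ x).card
  outMin : ∀ x ∈ VMin, 2 ≤ (succ x).card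
  outR : ∀ x ∈ VR, 1 ≤ (succ x).card
  /-- transition probabilities at random vertices -/
  prob : V → V → ℝ
  prob_nonneg : ∀ x y, 0 ≤ prob x y
  prob_support : ∀ x ∈ VR, ∀ y, y ∉ succ x → prob x y = 0
  prob_sum : ∀ x ∈ VR, (∑ y, prob x y) = 1
  /-- values of the sinks -/
  val : V → ℝ
  val_mem : ∀ x ∈ VS, val x ∈ Set.Icc (0:ℝ) 1

namespace SSG

variable {V : Type*} [Fintype V] [DecidableEq V]

/-- A positional MAX strategy: a choice of an out-neighbour at every MAX vertex
(normalised to the identity away from `VMax`). -/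
structure MaxStrategy (G : SSG V) where
  toFun : V → V
  mem_succ : ∀ x ∈ G.VMax, toFun x ∈ G.succ x
  eq_id : ∀ x ∉ G.VMax, toFun x = x

/-- A positional MIN strategy. -/
structure MinStrategy (G : SSG V) where
  toFun : V → V
  mem_succ : ∀ x ∈ G.VMin, toFun x ∈ G.succ x
  eq_id : ∀ x ∉ G.VMin, toFun x = x

/-- The one-step (monotone) operator on value vectors associated with `(σ,τ)`. -/
noncomputable def F (G : SSG V) (σ : G.MaxStrategy) (τ : G.MinStrategy)
    (w : V → unitInterval) (x : V) : unitInterval :=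
  if _hM : x ∈ G.VMax then w (σ.toFun x)
  else if _hN : x ∈ G.VMin then w (τ.toFun x)
  else if hR : x ∈ G.VR then
    ⟨∑ y, G.prob x y * (w y : ℝ), by
      constructor
      · exact Finset.sum_nonneg fun y _ =>
          mul_nonneg (G.prob_nonneg x y) (w y).2.1
      · calc (∑ y, G.prob x y * (w y : ℝ)) ≤ ∑ y, G.prob x y :=
              Finset.sum_le_sum fun y _ =>
                mul_le_of_le_one_right (G.prob_nonneg x y) (w y).2.2
          _ = 1 := G.prob_sum x hR⟩
  else ⟨G.val x, G.val_mem x (by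
    rcases G.cover x with h | h | h | h
    · exact absurd h _hM
    · exact absurd h _hN
    · exact absurd h hR
    · exact h)⟩

/-- The value vector `v_{σ,τ}`: the least fixed point (à la Knaster–Tarski) of `F`. -/
noncomputable def value (G : SSG V) (σ : G.MaxStrategy) (τ : G.MinStrategy) :
    V → unitInterval :=
  sInf {w : V → unitInterval | G.F σ τ w ≤ w}

/-- `τ` is a best response to `σ`. -/
def IsBestResponse (G : SSG V) (σ : G.MaxStrategy) (τ : G.MinStrategy) : Prop :=
  ∀ τ' : G.MinStrategy, G.value σ τ ≤ G.value σ τ'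

/-- `σ` is an optimal MAX strategy: `v_σ ≥ v_{σ'}` for every MAX strategy `σ'`
(values being computed against best responses). -/
def IsOptimal (G : SSG V) (σ : G.MaxStrategy) : Prop :=
  ∀ τ : G.MinStrategy, G.IsBestResponse σ τ →
    ∀ σ' : G.MaxStrategy, ∀ τ' : G.MinStrategy, G.IsBestResponse σ' τ' →
      G.value σ' τ' ≤ G.value σ τ

/-- The switch set `S_σ` of `σ`, computed with a best response `τ` to `σ`. -/
def switchSet (G : SSG V) (σ : G.MaxStrategy) (τ : G.MinStrategy) : Set V :=
  {x | x ∈ G.VMax ∧ ∃ y ∈ G.succ x, G.value σ τ x < G.value σ τ y}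

/-- `σ'` is a `σ`-switch (w.r.t. a best response `τ` to `σ`). -/
def IsSwitch (G : SSG V) (σ : G.MaxStrategy) (τ : G.MinStrategy)
    (σ' : G.MaxStrategy) : Prop :=
  σ' ≠ σ ∧
  (∀ x ∈ G.VMax, x ∉ G.switchSet σ τ → σ'.toFun x = σ.toFun x) ∧
  (∀ x ∈ G.switchSet σ τ, σ'.toFun x ≠ σ.toFun x →
    G.value σ τ x < G.value σ τ (σ'.toFun x))

/-- `σ` agrees with `σ₀` on `T`. -/
def AgreesOn (G : SSG V) (T : Set V) (σ₀ σ : G.MaxStrategy) : Prop :=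
  ∀ x ∈ T, σ.toFun x = σ₀.toFun x

/-- `σ` is an optimal MAX strategy of the subgame `G_{|T[σ₀]}`: it agrees with `σ₀` on `T`
and its value vector dominates that of every MAX strategy of `G` agreeing with `σ₀` on `T`. -/
def IsOptimalOn (G : SSG V) (T : Set V) (σ₀ σ : G.MaxStrategy) : Prop :=
  G.AgreesOn T σ₀ σ ∧
  ∀ σ' : G.MaxStrategy, G.AgreesOn T σ₀ σ' →
    ∀ τ τ' : G.MinStrategy, G.IsBestResponse σ τ → G.IsBestResponse σ' τ' →
      G.value σ' τ' ≤ G.value σ τ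

/-- `σ'` is a `(σ,T)`-super-switch (w.r.t. a best response `τ` to `σ`): it is obtained from an
intermediate `σ`-switch `σ''` that only switches inside `T`, by taking an optimal strategy of
the subgame `G_{|T[σ'']}`. -/
def IsSuperSwitch (G : SSG V) (σ : G.MaxStrategy) (τ : G.MinStrategy)
    (T : Set V) (σ' : G.MaxStrategy) : Prop :=
  ∃ σ'' : G.MaxStrategy, G.IsSwitch σ τ σ'' ∧
    (∀ x ∈ G.VMax, x ∉ T → σ''.toFun x = σ.toFun x) ∧
    G.IsOptimalOn T σ'' σ'

/-- A binary SSG: every MAX vertex has outdegree exactly 2. -/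
def Binary (G : SSG V) : Prop := ∀ x ∈ G.VMax, (G.succ x).card = 2

/-- `σb` is the total switch `σ̄` of `σ` (in a binary SSG): it switches to the other
out-neighbour exactly on the switch set of `σ`. -/
def IsTotalSwitch (G : SSG V) (σ : G.MaxStrategy) (τ : G.MinStrategy)
    (σb : G.MaxStrategy) : Prop :=
  (∀ x ∈ G.switchSet σ τ, σb.toFun x ≠ σ.toFun x) ∧
  (∀ x ∈ G.VMax, x ∉ G.switchSet σ τ → σb.toFun x = σ.toFun x)

end SSG

namespace SSG

variable {V : Type*} [Fintype V] [DecidableEq V]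

/-- The one-step operator is monotone. -/
theorem F_mono_aux (G : SSG V) (σ : G.MaxStrategy) (τ : G.MinStrategy)
    {w w' : V → unitInterval} (h : w ≤ w') : G.F σ τ w ≤ G.F σ τ w' := by
  intro x
  unfold F
  split_ifs with h1 h2 h3
  · exact h _
  · exact h _
  · exact Subtype.mk_le_mk.2 (Finset.sum_le_sum fun y _ =>
      mul_le_mul_of_nonneg_left (h y) (G.prob_nonneg x y))
  · exact le_rfl

/-- For every vector there is a greedy MIN strategy. -/
theorem exists_greedy_aux (G : SSG V) (σ : G.MaxStrategy) (w : V → unitInterval) :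
    ∃ τ : G.MinStrategy, ∀ τ' : G.MinStrategy, G.F σ τ w ≤ G.F σ τ' w := by
  have key : ∀ x, ∃ y, (x ∈ G.VMin → y ∈ G.succ x ∧ ∀ z ∈ G.succ x, w y ≤ w z) ∧
      (x ∉ G.VMin → y = x) := by
    intro x
    by_cases hx : x ∈ G.VMin
    · have hne : (G.succ x).Nonempty := Finset.card_pos.1 (by have := G.outMin x hx; omega)
      obtain ⟨y, hy, hmin⟩ := Finset.exists_min_image (G.succ x) w hne
      exact ⟨y, fun _ => ⟨hy, hmin⟩, fun h => absurd hx h⟩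
    · exact ⟨x, fun h => absurd h hx, fun _ => rfl⟩
  choose f hf hf' using key
  refine ⟨⟨f, fun x hx => (hf x hx).1, hf'⟩, fun τ' x => ?_⟩
  unfold F
  split_ifs with h1 h2 h3
  · exact le_rfl
  · exact (hf x h2).2 _ (τ'.mem_succ x h2)
  · exact le_rfl
  · exact le_rfl

end SSG

/-- every positional MAX strategy admits a positional MIN best response. -/
theorem exists_best_response {V : Type*} [Fintype V] [DecidableEq V] (G : SSG V)
    (σ : G.MaxStrategy) :
    ∃ τ : G.MinStrategy, G.IsBestResponse σ τ := by
  obtain ⟨τ, hτ⟩ := G.exists_greedy_aux σ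
    (sInf {w : V → unitInterval | ∃ τ' : G.MinStrategy, G.F σ τ' w ≤ w})
  refine ⟨τ, fun τ' => ?_⟩
  refine le_trans (b := sInf {w : V → unitInterval | ∃ τ' : G.MinStrategy, G.F σ τ' w ≤ w}) ?_ ?_
  · refine sInf_le ?_
    refine le_sInf (α := V → unitInterval) ?_
    rintro w ⟨τ₁, h₁⟩
    have hle : sInf {w : V → unitInterval | ∃ τ' : G.MinStrategy, G.F σ τ' w ≤ w} ≤ w :=
      sInf_le ⟨τ₁, h₁⟩
    exact (hτ τ₁).trans ((G.F_mono_aux σ τ₁ hle).trans h₁)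
  · exact sInf_le_sInf fun w hw => ⟨τ', hw⟩
end

section
/- In every simple stochastic game there exists a pair of positional strategies (σ*,τ*) that is an equilibrium: v_{σ,τ*} ≤ v_{σ*,τ*} ≤ v_{σ*,τ} pointwise for every MAX strategy σ and every MIN strategy τ. Moreover, the equilibrium value vector is unique: if (σ₁,τ₁) and (σ₂,τ₂) are two such pairs, then v_{σ₁,τ₁} = v_{σ₂,τ₂}. -/
open scoped BigOperators

/-- `(σs,τs)` is an equilibrium pair of positional strategies. -/
def SSG.IsEquilibrium {V : Type*} [Fintype V] [DecidableEq V] (G : SSG V)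
    (σs : G.MaxStrategy) (τs : G.MinStrategy) : Prop :=
  (∀ σ : G.MaxStrategy, G.value σ τs ≤ G.value σs τs) ∧
  (∀ τ : G.MinStrategy, G.value σs τs ≤ G.value σs τ)

namespace SSG

variable {V : Type*} [Fintype V] [DecidableEq V]

lemma F_max (G : SSG V) (σ : G.MaxStrategy) (τ : G.MinStrategy) (w : V → unitInterval) {x : V}
    (h : x ∈ G.VMax) : G.F σ τ w x = w (σ.toFun x) := by
  simp [F, h]

lemma F_min (G : SSG V) (σ : G.MaxStrategy) (τ : G.MinStrategy) (w : V → unitInterval) {x : V}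
    (hM : x ∉ G.VMax) (h : x ∈ G.VMin) : G.F σ τ w x = w (τ.toFun x) := by
  simp [F, h, hM]

lemma F_indep (G : SSG V) (σ σ' : G.MaxStrategy) (τ τ' : G.MinStrategy) (w : V → unitInterval)
    {x : V} (hM : x ∉ G.VMax) (h : x ∉ G.VMin) : G.F σ τ w x = G.F σ' τ' w x := by
  simp [F, h, hM]

lemma F_mono (G : SSG V) (σ : G.MaxStrategy) (τ : G.MinStrategy) : Monotone (G.F σ τ) := by
  intro a b hab x
  unfold F
  split_ifs
  · exact hab _
  · exact hab _
  · refine Subtype.mk_le_mk.mpr ?_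
    exact Finset.sum_le_sum fun y _ => mul_le_mul_of_nonneg_left (hab y) (G.prob_nonneg x y)
  · exact le_rfl

lemma F_sub_le (G : SSG V) (σ : G.MaxStrategy) (τ : G.MinStrategy) (a b : V → unitInterval)
    (M : ℝ) (hM : 0 ≤ M) (hab : ∀ x, (a x : ℝ) - b x ≤ M) (x : V) :
    (G.F σ τ a x : ℝ) - G.F σ τ b x ≤ M := by
  unfold F
  split_ifs with h1 h2 h3
  · exact hab _
  · exact hab _
  · simp only
    rw [← Finset.sum_sub_distrib]
    calc _ ≤ ∑ y, G.prob x y * M := Finset.sum_le_sum fun y _ => by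
            rw [← mul_sub]
            exact mul_le_mul_of_nonneg_left (hab y) (G.prob_nonneg x y)
      _ = M := by rw [← Finset.sum_mul, G.prob_sum x h3, one_mul]
  · simpa using hM

lemma F_cont (G : SSG V) (σ : G.MaxStrategy) (τ : G.MinStrategy) (x : V) :
    Continuous fun w => G.F σ τ w x := by
  unfold F
  split_ifs
  · fun_prop
  · fun_prop
  · fun_prop
  · fun_prop

lemma le_value_of (G : SSG V) (σ : G.MaxStrategy) (τ : G.MinStrategy) (w : V → unitInterval)
    (l : unitInterval) (hl : (l : ℝ) < 1) (hw : ∀ x, w x ≤ l * G.F σ τ w x) :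
    w ≤ G.value σ τ := by
  refine le_sInf fun u hu => ?_
  intro x0
  have : Nonempty V := ⟨x0⟩
  obtain ⟨x, hx⟩ := Finite.exists_max fun x => (w x : ℝ) - u x
  by_contra hlt
  have hpos : 0 < (w x : ℝ) - u x := by
    have h1 := hx x0
    have h2 : (u x0 : ℝ) < w x0 := not_le.mp hlt
    linarith
  have h1 := G.F_sub_le σ τ w u _ hpos.le hx x
  have h2 : (w x : ℝ) ≤ l * G.F σ τ w x := by exact_mod_cast hw x
  have h3 : (G.F σ τ u x : ℝ) ≤ u x := hu x
  have h4 : 0 ≤ (G.F σ τ u x : ℝ) := (G.F σ τ u x).2.1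
  have h5 : 0 ≤ (l : ℝ) := l.2.1
  nlinarith

/-- discounted Shapley operator -/
noncomputable def T (G : SSG V) (σ : G.MaxStrategy) (τ : G.MinStrategy) (l : unitInterval)
    (w : V → unitInterval) (x : V) : unitInterval :=
  l * (if x ∈ G.VMax then (G.succ x).sup w
    else if x ∈ G.VMin then (G.succ x).inf w else G.F σ τ w x)

lemma unit_mul_le (l : unitInterval) {a b : unitInterval} (h : a ≤ b) : l * a ≤ l * b := by
  have : (l : ℝ) * a ≤ l * b := mul_le_mul_of_nonneg_left h l.2.1
  exact_mod_cast this

lemma T_mono (G : SSG V) (σ : G.MaxStrategy) (τ : G.MinStrategy) (l : unitInterval) :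
    Monotone (G.T σ τ l) := by
  intro a b hab x
  unfold T
  apply unit_mul_le
  split_ifs
  · exact Finset.sup_mono_fun fun y _ => hab y
  · exact Finset.inf_mono_fun fun y _ => hab y
  · exact G.F_mono σ τ hab x

lemma succ_max (G : SSG V) {x : V} (h : x ∈ G.VMax) : (G.succ x).Nonempty :=
  Finset.card_pos.mp (by have := G.outMax x h; omega)

lemma succ_min (G : SSG V) {x : V} (h : x ∈ G.VMin) : (G.succ x).Nonempty :=
  Finset.card_pos.mp (by have := G.outMin x h; omega)

lemma exists_greedy_max (G : SSG V) (w : V → unitInterval) :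
    ∃ σ : G.MaxStrategy, ∀ x ∈ G.VMax, w (σ.toFun x) = (G.succ x).sup w := by
  have : ∀ x, ∃ y, (x ∈ G.VMax → y ∈ G.succ x ∧ w y = (G.succ x).sup w) ∧
      (x ∉ G.VMax → y = x) := by
    intro x
    by_cases h : x ∈ G.VMax
    · obtain ⟨y, hy, e⟩ := Finset.exists_mem_eq_sup _ (G.succ_max h) w
      exact ⟨y, fun _ => ⟨hy, e.symm⟩, fun h' => absurd h h'⟩
    · exact ⟨x, fun h' => absurd h' h, fun _ => rfl⟩
  choose f hf using this
  exact ⟨⟨f, fun x hx => ((hf x).1 hx).1, fun x hx => (hf x).2 hx⟩, fun x hx => ((hf x).1 hx).2⟩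

lemma exists_greedy_min (G : SSG V) (w : V → unitInterval) :
    ∃ τ : G.MinStrategy, ∀ x ∈ G.VMin, w (τ.toFun x) = (G.succ x).inf w := by
  have : ∀ x, ∃ y, (x ∈ G.VMin → y ∈ G.succ x ∧ w y = (G.succ x).inf w) ∧
      (x ∉ G.VMin → y = x) := by
    intro x
    by_cases h : x ∈ G.VMin
    · obtain ⟨y, hy, e⟩ := Finset.exists_mem_eq_inf _ (G.succ_min h) w
      exact ⟨y, fun _ => ⟨hy, e.symm⟩, fun h' => absurd h h'⟩
    · exact ⟨x, fun h' => absurd h' h, fun _ => rfl⟩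
  choose f hf using this
  exact ⟨⟨f, fun x hx => ((hf x).1 hx).1, fun x hx => (hf x).2 hx⟩, fun x hx => ((hf x).1 hx).2⟩

lemma exists_discounted (G : SSG V) (l : unitInterval) :
    ∃ (w : V → unitInterval) (σ : G.MaxStrategy) (τ : G.MinStrategy),
      (∀ τ' x, w x ≤ l * G.F σ τ' w x) ∧ (∀ σ' x, l * G.F σ' τ w x ≤ w x) := by
  obtain ⟨σ0, -⟩ := G.exists_greedy_max 0
  obtain ⟨τ0, -⟩ := G.exists_greedy_min 0
  let f : (V → unitInterval) →o (V → unitInterval) := ⟨G.T σ0 τ0 l, G.T_mono σ0 τ0 l⟩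
  obtain ⟨w, hw⟩ : ∃ w, G.T σ0 τ0 l w = w := ⟨f.lfp, f.map_lfp⟩
  obtain ⟨σ, hσ⟩ := G.exists_greedy_max w
  obtain ⟨τ, hτ⟩ := G.exists_greedy_min w
  refine ⟨w, σ, τ, fun τ' x => ?_, fun σ' x => ?_⟩
  · conv_lhs => rw [← hw]
    apply unit_mul_le
    split_ifs with h1 h2
    · rw [G.F_max _ _ _ h1, hσ x h1]
    · rw [G.F_min _ _ _ h1 h2]
      exact Finset.inf_le (τ'.mem_succ x h2)
    · exact (G.F_indep _ _ _ _ w h1 h2).le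
  · conv_rhs => rw [← hw]
    apply unit_mul_le
    split_ifs with h1 h2
    · rw [G.F_max _ _ _ h1]
      exact Finset.le_sup (σ'.mem_succ x h1)
    · rw [G.F_min _ _ _ h1 h2, hτ x h2]
    · exact (G.F_indep _ _ _ _ w h1 h2).le

instance (G : SSG V) : Finite G.MaxStrategy :=
  Finite.of_injective MaxStrategy.toFun fun a b h => by cases a; cases b; congr

instance (G : SSG V) : Finite G.MinStrategy :=
  Finite.of_injective MinStrategy.toFun fun a b h => by cases a; cases b; congr

lemma ultra_const {α : Type*} [Finite α] (U : Ultrafilter ℕ) (s : ℕ → α) :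
    ∃ a, ∀ᶠ n in U, s n = a := by
  obtain ⟨a, ha⟩ := (U.map s).eq_pure_of_finite
  refine ⟨a, ?_⟩
  have : {a} ∈ U.map s := by rw [ha]; exact rfl
  exact this

lemma exists_eq (G : SSG V) : ∃ (σs : G.MaxStrategy) (τs : G.MinStrategy),
    G.IsEquilibrium σs τs := by
  let L : ℕ → unitInterval := fun n => ⟨1 - 1 / ((n : ℝ) + 1), by
    constructor
    · rw [sub_nonneg, div_le_one (by positivity)]
      have : (0 : ℝ) ≤ n := by positivity
      linarith
    · have : (0 : ℝ) ≤ 1 / ((n : ℝ) + 1) := by positivity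
      linarith⟩
  have hL : ∀ n, (L n : ℝ) < 1 := fun n => by
    have : (0 : ℝ) < 1 / ((n : ℝ) + 1) := by positivity
    show 1 - 1 / ((n : ℝ) + 1) < 1
    linarith
  have hLt : Filter.Tendsto L Filter.atTop (nhds 1) := by
    rw [tendsto_subtype_rng]
    have := (tendsto_one_div_add_atTop_nhds_zero_nat (𝕜 := ℝ)).const_sub 1
    simpa [L] using this
  choose w s t hs ht using fun n => G.exists_discounted (L n)
  let U : Ultrafilter ℕ := Filter.hyperfilter ℕ
  have hU : (U : Filter ℕ) ≤ Filter.atTop := by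
    rw [← Nat.cofinite_eq_atTop]; exact Filter.hyperfilter_le_cofinite
  obtain ⟨σ, hσ⟩ := ultra_const U s
  obtain ⟨τ, hτ⟩ := ultra_const U t
  have hw : Filter.Tendsto w U (nhds (U.map w).lim) := (U.map w).le_nhds_lim
  set W := (U.map w).lim
  have hlow : ∀ τ', W ≤ G.value σ τ' := fun τ' => by
    refine le_of_tendsto hw (hσ.mono fun n hn => ?_)
    subst hn
    exact G.le_value_of _ _ _ _ (hL n) (hs n τ')
  have hup : ∀ σ', G.value σ' τ ≤ W := fun σ' => by
    refine sInf_le ?_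
    intro x
    have h1 : Filter.Tendsto (fun n => L n * G.F σ' τ (w n) x) U (nhds (1 * G.F σ' τ W x)) :=
      (hLt.mono_left hU).mul (((G.F_cont σ' τ x).tendsto W).comp hw)
    rw [one_mul] at h1
    have h2 : Filter.Tendsto (fun n => w n x) U (nhds (W x)) :=
      ((continuous_apply x).tendsto W).comp hw
    refine le_of_tendsto_of_tendsto h1 h2 (hτ.mono fun n hn => ?_)
    subst hn
    exact ht n σ' x
  exact ⟨σ, τ, fun σ' => (hup σ').trans (hlow τ), fun τ' => (hup σ).trans (hlow τ')⟩

end SSG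

/-- there exists an equilibrium pair of positional strategies, and the
equilibrium value vector is unique. -/
theorem exists_equilibrium_and_unique_value {V : Type*} [Fintype V] [DecidableEq V]
    (G : SSG V) :
    (∃ (σs : G.MaxStrategy) (τs : G.MinStrategy), G.IsEquilibrium σs τs) ∧
    (∀ (σ₁ : G.MaxStrategy) (τ₁ : G.MinStrategy) (σ₂ : G.MaxStrategy) (τ₂ : G.MinStrategy),
      G.IsEquilibrium σ₁ τ₁ → G.IsEquilibrium σ₂ τ₂ →
        G.value σ₁ τ₁ = G.value σ₂ τ₂) := by
  exact ⟨G.exists_eq, fun σ₁ τ₁ σ₂ τ₂ h₁ h₂ =>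
    le_antisymm ((h₁.2 τ₂).trans (h₂.1 σ₁)) ((h₂.2 τ₁).trans (h₁.1 σ₂))⟩
end

section
/- For any MAX strategy σ of an SSG G, σ is optimal in the subgame G_{|S_σ[σ]}; that is, for every MAX strategy σ' of G that agrees with σ on the switch set S_σ, one has v_{σ'} ≤ v_σ pointwise. -/
open scoped BigOperators

/-- The one-step operator is monotone. -/
theorem SSG.F_mono_s5 {V : Type*} [Fintype V] [DecidableEq V] (G : SSG V)
    (σ : G.MaxStrategy) (τ : G.MinStrategy) {w w' : V → unitInterval} (h : w ≤ w') :
    G.F σ τ w ≤ G.F σ τ w' := by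
  intro x
  unfold SSG.F
  split_ifs
  · exact h _
  · exact h _
  · exact Subtype.mk_le_mk.2 (Finset.sum_le_sum fun y _ =>
      mul_le_mul_of_nonneg_left (h y) (G.prob_nonneg x y))
  · exact le_refl _

/-- The value vector is a pre-fixed point. -/
theorem SSG.F_value_le {V : Type*} [Fintype V] [DecidableEq V] (G : SSG V)
    (σ : G.MaxStrategy) (τ : G.MinStrategy) :
    G.F σ τ (G.value σ τ) ≤ G.value σ τ := by
  refine le_sInf fun w hw => ?_
  exact le_trans (G.F_mono_s5 σ τ (sInf_le hw)) hw

/-- `σ` is optimal in the subgame `G_{|S_σ[σ]}`, i.e. its value vector dominates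
that of every MAX strategy agreeing with `σ` on the switch set `S_σ`. -/
theorem optimal_on_switchSet {V : Type*} [Fintype V] [DecidableEq V] (G : SSG V)
    (σ : G.MaxStrategy) (τ : G.MinStrategy) (hbr : G.IsBestResponse σ τ) :
    G.IsOptimalOn (G.switchSet σ τ) σ σ := by
  refine ⟨fun _ _ => rfl, fun σ' hσ' τ₂ τ' _ hτ' => ?_⟩
  refine le_trans (hτ' τ) (le_trans ?_ (hbr τ₂))
  refine sInf_le (a := G.value σ τ) ?_
  intro x
  have hx := G.F_value_le σ τ x
  by_cases hM : x ∈ G.VMax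
  · have e : ∀ s : G.MaxStrategy,
        G.F s τ (G.value σ τ) x = G.value σ τ (s.toFun x) := by
      intro s
      simp [SSG.F, hM]
    rw [e] at hx
    rw [e]
    by_cases hS : x ∈ G.switchSet σ τ
    · rw [hσ' x hS]
      exact hx
    · by_contra hlt
      exact hS ⟨hM, _, σ'.mem_succ x hM, not_le.1 hlt⟩
  · have e : G.F σ' τ (G.value σ τ) x = G.F σ τ (G.value σ τ) x := by
      simp [SSG.F, hM]
    rw [e]
    exact hx
end

section
/- Let G be an SSG, σ* an optimal MAX strategy of G, and T ⊆ V_MAX. If σ is a MAX strategy agreeing with σ* on T that is optimal in the subgame G_{|T[σ*]}, then σ is optimal in G, and v_σ = v_{σ*}. -/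
open scoped BigOperators

namespace SSG

variable {V : Type*} [Fintype V] [DecidableEq V]

/-- Every MIN vertex can choose a successor minimising a given vector. -/
theorem exists_argmin_aux (G : SSG V) (w : V → unitInterval) :
    ∃ τ : G.MinStrategy, ∀ x ∈ G.VMin, ∀ y ∈ G.succ x, w (τ.toFun x) ≤ w y := by
  have hx : ∀ x, ∃ y, (x ∈ G.VMin → y ∈ G.succ x ∧ ∀ z ∈ G.succ x, w y ≤ w z) ∧
      (x ∉ G.VMin → y = x) := by
    intro x
    by_cases hm : x ∈ G.VMin
    · have hne : (G.succ x).Nonempty := by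
        rw [← Finset.card_pos]
        have := G.outMin x hm
        omega
      obtain ⟨y, hy, hy'⟩ := Finset.exists_min_image (G.succ x) w hne
      exact ⟨y, fun _ => ⟨hy, hy'⟩, fun hn => absurd hm hn⟩
    · exact ⟨x, fun h => absurd h hm, fun _ => rfl⟩
  choose f hf hf' using hx
  exact ⟨⟨f, fun x h => (hf x h).1, hf'⟩, fun x h => (hf x h).2⟩

theorem exists_bestResponse_aux (G : SSG V) (σ : G.MaxStrategy) :
    ∃ τ : G.MinStrategy, G.IsBestResponse σ τ := by
  set S : Set (V → unitInterval) := {w | ∃ τ : G.MinStrategy, G.F σ τ w ≤ w} with hS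
  obtain ⟨τ, hτ⟩ := G.exists_argmin_aux (sInf S)
  have key : G.F σ τ (sInf S) ≤ sInf S := by
    refine le_sInf ?_
    rintro w ⟨τ', hw⟩
    have h1 : G.F σ τ (sInf S) ≤ G.F σ τ' (sInf S) := by
      intro x
      unfold F
      split_ifs with hM hN
      · exact le_rfl
      · exact hτ x hN _ (τ'.mem_succ x hN)
      · exact le_rfl
      · exact le_rfl
    have hmem : w ∈ S := ⟨τ', hw⟩
    have h2 : sInf S ≤ w := sInf_le hmem
    exact h1.trans ((G.F_mono_aux σ τ' h2).trans hw)
  refine ⟨τ, fun τ' => ?_⟩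
  have h1 : G.value σ τ ≤ sInf S := sInf_le key
  exact h1.trans (sInf_le_sInf fun w hw => ⟨τ', hw⟩)

end SSG

/-- if `σs` is optimal in `G` and `σ` is optimal in the subgame `G_{|T[σs]}`,
then `σ` is optimal in `G` and `v_σ = v_{σs}`. -/
theorem optimalOn_of_optimal_is_optimal {V : Type*} [Fintype V] [DecidableEq V] (G : SSG V)
    (σs : G.MaxStrategy) (hopt : G.IsOptimal σs) (T : Set V) (hT : T ⊆ ↑G.VMax)
    (σ : G.MaxStrategy) (h : G.IsOptimalOn T σs σ) :
    G.IsOptimal σ ∧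
    ∀ τ τs : G.MinStrategy, G.IsBestResponse σ τ → G.IsBestResponse σs τs →
      G.value σ τ = G.value σs τs := by
  have hσs : G.AgreesOn T σs σs := fun _ _ => rfl
  refine ⟨fun τ hτ σ' τ' hτ' => ?_, fun τ τs hτ hτs => ?_⟩
  · obtain ⟨τs, hτs⟩ := G.exists_bestResponse_aux σs
    exact (hopt τs hτs σ' τ' hτ').trans (h.2 σs hσs τ τs hτ hτs)
  · exact le_antisymm (hopt τs hτs σ τ hτ) (h.2 σs hσs τ τs hτ hτs)
end

section
/- Let G be an SSG, x ∈ V_MAX and x' an out-neighbour of x. If there exists an optimal MAX strategy σ* with σ*(x) = x', then there is no MAX strategy σ with σ(x) = x' whose switch set equals the singleton {x}. -/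
open scoped BigOperators

namespace SSG

section Aux

variable {V : Type*} [Fintype V] [DecidableEq V] (G : SSG V)

theorem aux_F_max (σ : G.MaxStrategy) (τ : G.MinStrategy) (w : V → unitInterval) {z : V}
    (h : z ∈ G.VMax) : G.F σ τ w z = w (σ.toFun z) := by
  simp [F, h]

theorem aux_F_min (σ : G.MaxStrategy) (τ : G.MinStrategy) (w : V → unitInterval) {z : V}
    (h : z ∈ G.VMin) : G.F σ τ w z = w (τ.toFun z) := by
  have h1 : z ∉ G.VMax := fun h' => Finset.disjoint_left.1 G.disjMaxMin h' h
  simp [F, h, h1]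

theorem aux_F_rand (σ : G.MaxStrategy) (τ : G.MinStrategy) (w : V → unitInterval) {z : V}
    (h : z ∈ G.VR) : ((G.F σ τ w z : unitInterval) : ℝ) = ∑ y, G.prob z y * (w y : ℝ) := by
  have h1 : z ∉ G.VMax := fun h' => Finset.disjoint_left.1 G.disjMaxR h' h
  have h2 : z ∉ G.VMin := fun h' => Finset.disjoint_left.1 G.disjMinR h' h
  simp [F, h, h1, h2]

theorem aux_F_sink (σ : G.MaxStrategy) (τ : G.MinStrategy) (w : V → unitInterval) {z : V}
    (h : z ∈ G.VS) : ((G.F σ τ w z : unitInterval) : ℝ) = G.val z := by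
  have h1 : z ∉ G.VMax := fun h' => Finset.disjoint_left.1 G.disjMaxS h' h
  have h2 : z ∉ G.VMin := fun h' => Finset.disjoint_left.1 G.disjMinS h' h
  have h3 : z ∉ G.VR := fun h' => Finset.disjoint_left.1 G.disjRS h' h
  simp [F, h1, h2, h3]

/-- Comparison of two one-step operators. -/
theorem aux_F_le (σ σ' : G.MaxStrategy) (τ τ' : G.MinStrategy) (w w' : V → unitInterval)
    (hw : w ≤ w') (hM : ∀ z ∈ G.VMax, w (σ.toFun z) ≤ w' (σ'.toFun z))
    (hN : ∀ z ∈ G.VMin, w (τ.toFun z) ≤ w' (τ'.toFun z)) :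
    G.F σ τ w ≤ G.F σ' τ' w' := by
  intro z
  rcases G.cover z with h | h | h | h
  · rw [aux_F_max G _ _ _ h, aux_F_max G _ _ _ h]; exact hM z h
  · rw [aux_F_min G _ _ _ h, aux_F_min G _ _ _ h]; exact hN z h
  · rw [← Subtype.coe_le_coe, aux_F_rand G _ _ _ h, aux_F_rand G _ _ _ h]
    exact Finset.sum_le_sum fun y _ =>
      mul_le_mul_of_nonneg_left (Subtype.coe_le_coe.2 (hw y)) (G.prob_nonneg z y)
  · rw [← Subtype.coe_le_coe, aux_F_sink G _ _ _ h, aux_F_sink G _ _ _ h]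

theorem aux_F_mono (σ : G.MaxStrategy) (τ : G.MinStrategy) {w w' : V → unitInterval}
    (hw : w ≤ w') : G.F σ τ w ≤ G.F σ τ w' :=
  aux_F_le G σ σ τ τ w w' hw (fun _ _ => hw _) (fun _ _ => hw _)

theorem aux_value_le (σ : G.MaxStrategy) (τ : G.MinStrategy) {w : V → unitInterval}
    (h : G.F σ τ w ≤ w) : G.value σ τ ≤ w := sInf_le h

theorem aux_value_fix (σ : G.MaxStrategy) (τ : G.MinStrategy) :
    G.F σ τ (G.value σ τ) = G.value σ τ := by
  have h : G.F σ τ (G.value σ τ) ≤ G.value σ τ :=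
    le_sInf fun w hw => (aux_F_mono G σ τ (aux_value_le G σ τ hw)).trans hw
  exact le_antisymm h (aux_value_le G σ τ (aux_F_mono G σ τ h))

theorem aux_exists_br (σ : G.MaxStrategy) : ∃ τ : G.MinStrategy, G.IsBestResponse σ τ ∧
    ∀ z ∈ G.VMin, ∀ y ∈ G.succ z, G.value σ τ z ≤ G.value σ τ y := by
  set u : V → unitInterval := sInf (Set.range (G.value σ)) with hu
  have hne : ∀ z ∈ G.VMin, (G.succ z).Nonempty := fun z hz =>
    Finset.card_pos.1 (by have := G.outMin z hz; omega)
  have key : ∀ z, ∃ t, (z ∈ G.VMin → t ∈ G.succ z ∧ ∀ y ∈ G.succ z, u t ≤ u y) ∧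
      (z ∉ G.VMin → t = z) := by
    intro z
    by_cases hz : z ∈ G.VMin
    · obtain ⟨t, ht, hmin⟩ := Finset.exists_min_image (G.succ z) u (hne z hz)
      exact ⟨t, fun _ => ⟨ht, hmin⟩, fun h => absurd hz h⟩
    · exact ⟨z, fun h => absurd h hz, fun _ => rfl⟩
  choose t ht1 ht2 using key
  let τ : G.MinStrategy := ⟨t, fun z hz => (ht1 z hz).1, ht2⟩
  have hule : ∀ τ', u ≤ G.value σ τ' := fun τ' => sInf_le ⟨τ', rfl⟩
  have hpre : G.F σ τ u ≤ u := by
    refine le_sInf ?_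
    rintro _ ⟨τ', rfl⟩
    refine le_of_le_of_eq ?_ (aux_value_fix G σ τ')
    refine aux_F_le G σ σ τ τ' _ _ (hule τ') (fun _ _ => hule τ' _) ?_
    intro z hz
    exact ((ht1 z hz).2 _ (τ'.mem_succ z hz)).trans (hule τ' _)
  have hval : G.value σ τ = u := le_antisymm (aux_value_le G σ τ hpre) (hule τ)
  refine ⟨τ, fun τ' => hval ▸ hule τ', fun z hz y hy => ?_⟩
  rw [← aux_value_fix G σ τ, aux_F_min G _ _ _ hz, aux_value_fix, hval]
  exact (ht1 z hz).2 y hy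

theorem aux_br_min (σ : G.MaxStrategy) (τ : G.MinStrategy) (h : G.IsBestResponse σ τ) :
    ∀ z ∈ G.VMin, ∀ y ∈ G.succ z, G.value σ τ z ≤ G.value σ τ y := by
  obtain ⟨τ0, h0, h1⟩ := aux_exists_br G σ
  rw [le_antisymm (h τ0) (h0 τ)]
  exact h1

/-- A single strictly improving switch does not decrease the value. -/
theorem aux_improve (σ σ' : G.MaxStrategy) (τ τ' : G.MinStrategy) (h : G.IsBestResponse σ τ)
    (x : V) (hx : x ∈ G.VMax) (hlt : G.value σ τ x < G.value σ τ (σ'.toFun x))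
    (hag : ∀ z, z ≠ x → σ'.toFun z = σ.toFun z) :
    G.value σ τ ≤ G.value σ' τ' := by
  classical
  have hmin := aux_br_min G σ τ h
  have hbr := h τ'
  have hv := aux_value_fix G σ τ
  have hw := aux_value_fix G σ' τ'
  set v := G.value σ τ with hvdef
  set w := G.value σ' τ' with hwdef
  let D : V → ℝ := fun z => (v z : ℝ) - w z
  have : Nonempty V := ⟨x⟩
  obtain ⟨z0, hz0⟩ := Finite.exists_max D
  by_contra hcon
  have hpos : 0 < D z0 := by
    by_contra hn
    apply hcon
    intro z
    rw [← Subtype.coe_le_coe]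
    have := hz0 z
    simp only [D] at this hn
    linarith
  let w0 : V → unitInterval := fun z => if D z = D z0 then 0 else 1
  have hpre : G.F σ τ' w0 ≤ w0 := by
    intro z
    by_cases hA : D z = D z0
    swap
    · simp only [w0, if_neg hA]; exact unitInterval.le_one'
    have hge : ∀ y, (v z : ℝ) ≤ v y → (w z : ℝ) = w y → w0 y ≤ w0 z := by
      intro y h1 h2
      have h3 : D y = D z0 := by
        refine le_antisymm (hz0 y) ?_
        rw [← hA]
        simp only [D]
        linarith
      simp only [w0, if_pos hA, if_pos h3]
      exact le_rfl
    rcases G.cover z with hz | hz | hz | hz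
    · rw [aux_F_max G _ _ _ hz]
      have hvz := congrFun hv z
      have hwz := congrFun hw z
      rw [aux_F_max G _ _ _ hz] at hvz hwz
      have hzx : z ≠ x := by
        rintro rfl
        have h1 := hz0 (σ'.toFun z)
        have h2 : (v z : ℝ) < v (σ'.toFun z) := Subtype.coe_lt_coe.2 hlt
        rw [← hA] at h1
        simp only [D] at h1
        rw [hwz] at h1
        linarith
      rw [hag z hzx] at hwz
      exact hge _ (by rw [hvz]) (by rw [hwz])
    · rw [aux_F_min G _ _ _ hz]
      have hwz := congrFun hw z
      rw [aux_F_min G _ _ _ hz] at hwz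
      exact hge _ (Subtype.coe_le_coe.2 (hmin z hz _ (τ'.mem_succ z hz))) (by rw [hwz])
    · rw [← Subtype.coe_le_coe, aux_F_rand G _ _ _ hz]
      have hvz := congrArg (Subtype.val) (congrFun hv z)
      have hwz := congrArg (Subtype.val) (congrFun hw z)
      rw [aux_F_rand G _ _ _ hz] at hvz hwz
      have hsum : ∑ y, G.prob z y * (D z0 - D y) = 0 := by
        have e : ∀ y, G.prob z y * (D z0 - D y) =
            G.prob z y * D z0 - (G.prob z y * (v y : ℝ) - G.prob z y * (w y : ℝ)) := by
          intro y
          simp only [D]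
          ring
        rw [Finset.sum_congr rfl fun y _ => e y, Finset.sum_sub_distrib, Finset.sum_sub_distrib,
          ← Finset.sum_mul, G.prob_sum z hz, hvz, hwz, ← hA]
        simp only [D]
        ring
      have hzero := (Finset.sum_eq_zero_iff_of_nonneg (fun y _ =>
        mul_nonneg (G.prob_nonneg z y) (sub_nonneg.2 (hz0 y)))).1 hsum
      have : ∑ y, G.prob z y * (w0 y : ℝ) = 0 := by
        refine Finset.sum_eq_zero fun y hy => ?_
        by_cases hy' : D y = D z0
        · simp [w0, hy']
        · rcases mul_eq_zero.1 (hzero y hy) with h1 | h1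
          · rw [h1, zero_mul]
          · exact absurd (sub_eq_zero.1 h1).symm hy'
      rw [this]
      exact (w0 z).2.1
    · exfalso
      have hvz := congrArg (Subtype.val) (congrFun hv z)
      have hwz := congrArg (Subtype.val) (congrFun hw z)
      rw [aux_F_sink G _ _ _ hz] at hvz hwz
      rw [← hA] at hpos
      simp only [D] at hpos
      linarith
  have h1 : v z0 ≤ w0 z0 := (hbr.trans (aux_value_le G σ τ' hpre)) z0
  have h2 : w0 z0 = 0 := by simp [w0]
  rw [h2, ← Subtype.coe_le_coe] at h1
  have h3 := (w z0).2.1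
  simp only [D] at hpos
  have h4 : ((0 : unitInterval) : ℝ) = 0 := rfl
  linarith

end Aux

end SSG

/-- if some optimal MAX strategy plays `x ↦ x'`, then no MAX strategy playing
`x ↦ x'` has switch set exactly `{x}`. -/
theorem no_singleton_switchSet_of_optimal_choice {V : Type*} [Fintype V] [DecidableEq V]
    (G : SSG V) (x x' : V) (hx : x ∈ G.VMax) (hx' : x' ∈ G.succ x)
    (σs : G.MaxStrategy) (hopt : G.IsOptimal σs) (hsx : σs.toFun x = x') :
    ∀ (σ : G.MaxStrategy) (τ : G.MinStrategy), G.IsBestResponse σ τ →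
      σ.toFun x = x' → G.switchSet σ τ ≠ {x} := by
  intro σ τ hbr hσx hS
  have hxS : x ∈ G.switchSet σ τ := by rw [hS]; rfl
  obtain ⟨-, y, hy, hlt⟩ := hxS
  -- `σs` played against `τ` is dominated by `σ`
  have hdom : G.value σs τ ≤ G.value σ τ := by
    apply SSG.aux_value_le
    intro z
    have hfix := congrFun (SSG.aux_value_fix G σ τ) z
    by_cases hz : z ∈ G.VMax
    · rw [SSG.aux_F_max G _ _ _ hz]
      by_cases hzx : z = x
      · subst hzx
        rw [SSG.aux_F_max G _ _ _ hz, hσx] at hfix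
        rw [hsx, hfix]
      · by_contra hn
        have : z ∈ G.switchSet σ τ := ⟨hz, _, σs.mem_succ z hz, not_le.1 hn⟩
        rw [hS] at this
        exact hzx this
    · have : G.F σs τ (G.value σ τ) z = G.F σ τ (G.value σ τ) z := by
        simp [SSG.F, hz]
      rw [this, hfix]
  obtain ⟨τs, hτs, -⟩ := SSG.aux_exists_br G σs
  let σ' : G.MaxStrategy := ⟨Function.update σ.toFun x y, by
    intro z hz
    by_cases hzx : z = x
    · subst hzx; simpa using hy
    · simpa [hzx] using σ.mem_succ z hz, by
    intro z hz
    have hzx : z ≠ x := fun e => hz (e ▸ hx)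
    simpa [hzx] using σ.eq_id z hz⟩
  have hσ'x : σ'.toFun x = y := by simp [σ']
  obtain ⟨τ', hτ', -⟩ := SSG.aux_exists_br G σ'
  have himp := SSG.aux_improve G σ σ' τ τ' hbr x hx (by rw [hσ'x]; exact hlt)
    (fun z hz => by simp [σ', hz])
  have hle : G.value σ' τ' ≤ G.value σ τ :=
    (hopt τs hτs σ' τ' hτ').trans ((hτs τ).trans hdom)
  have hfix := congrFun (SSG.aux_value_fix G σ' τ') x
  rw [SSG.aux_F_max G _ _ _ hx, hσ'x] at hfix
  have h1 := himp y
  rw [hfix] at h1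
  exact absurd (h1.trans (hle x)) (not_le.2 hlt)
end
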